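/- arXiv:2410.14097 — 2 statements merged into one kernel-verified Lean document; each statement's English description precedes it below -/
import Mathlib

section
/- Let R be a commutative ring and A a finitely presented R-module with a presentation P₁ →d P₀ → A → 0 in which P₀, P₁ are finitely generated projective. Write (−)* = Hom_R(−, R) and Tr A := coker(d* : P₀* → P₁*). Then for every R-module B there exist homomorphisms making the sequence 0 → Ext¹_R(Tr A, B) → A ⊗_R B →ρ Hom_R(A*, B) → Ext²_R(Tr A, B) → 0 exact, where ρ is the canonical map determined by ρ(a ⊗ b)(f) = f(a)·b for a ∈ A, b ∈ B, f ∈ A*. -/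
open TensorProduct CategoryTheory

/-- The transpose `Tr A = coker(d* : P₀* → P₁*)` of a finitely presented module with
presentation `P₁ →d P₀ → A → 0` by finitely generated projectives. -/
def Transpose {R : Type} [CommRing R] {P₁ P₀ : Type}
    [AddCommGroup P₁] [Module R P₁] [AddCommGroup P₀] [Module R P₀]
    (d : P₁ →ₗ[R] P₀) : Type :=
  (P₁ →ₗ[R] R) ⧸ LinearMap.range (d.dualMap : (P₀ →ₗ[R] R) →ₗ[R] (P₁ →ₗ[R] R))

instance {R : Type} [CommRing R] {P₁ P₀ : Type}
    [AddCommGroup P₁] [Module R P₁] [AddCommGroup P₀] [Module R P₀]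
    (d : P₁ →ₗ[R] P₀) : AddCommGroup (Transpose d) :=
  inferInstanceAs (AddCommGroup ((P₁ →ₗ[R] R) ⧸ LinearMap.range d.dualMap))

instance {R : Type} [CommRing R] {P₁ P₀ : Type}
    [AddCommGroup P₁] [Module R P₁] [AddCommGroup P₀] [Module R P₀]
    (d : P₁ →ₗ[R] P₀) : Module R (Transpose d) :=
  inferInstanceAs (Module R ((P₁ →ₗ[R] R) ⧸ LinearMap.range d.dualMap))

/-- The abelian group `Ext^n_R(Tr A, B)`. -/
noncomputable def ExtTr {R : Type} [CommRing R] {P₁ P₀ : Type}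
    [AddCommGroup P₁] [Module R P₁] [AddCommGroup P₀] [Module R P₀]
    (d : P₁ →ₗ[R] P₀) (n : ℕ) (B : Type) [AddCommGroup B] [Module R B] : Type :=
  ((Ext R (ModuleCat R) n).obj (Opposite.op (ModuleCat.of R (Transpose d)))).obj
    (ModuleCat.of R B)

noncomputable instance {R : Type} [CommRing R] {P₁ P₀ : Type}
    [AddCommGroup P₁] [Module R P₁] [AddCommGroup P₀] [Module R P₀]
    (d : P₁ →ₗ[R] P₀) (n : ℕ) (B : Type) [AddCommGroup B] [Module R B] :
    AddCommGroup (ExtTr d n B) :=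
  inferInstanceAs (AddCommGroup
    (((Ext R (ModuleCat R) n).obj (Opposite.op (ModuleCat.of R (Transpose d)))).obj
      (ModuleCat.of R B)))

noncomputable section

lemma ext_aux {R : Type} [CommRing R] {X : ModuleCat.{0} R} (P : ProjectiveResolution X) (B : ModuleCat.{0} R) (n : ℕ) :
    ∃ φ : LinearMap.ker (LinearMap.lcomp R B (P.complex.d (n+2) (n+1)).hom) →ₗ[R]
        ((Ext R (ModuleCat R) (n+1)).obj (Opposite.op X)).obj B,
      Function.Surjective φ ∧ ∀ z, φ z = 0 ↔ ∃ g : P.complex.X n →ₗ[R] B, z.1 = g ∘ₗ (P.complex.d (n+1) n).hom := by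
  let K := P.complex.linearYonedaObj R B
  let i1 := P.isoExt (R := R) (n+1) B
  let S := K.sc' n (n+1) (n+2)
  let i2 : K.homology (n+1) ≅ S.homology := ShortComplex.homologyMapIso (K.isoSc' n (n+1) (n+2) (by simp) (by simp))
  let i3 := S.moduleCatHomologyIso
  let i : _ ≃ₗ[R] (LinearMap.ker S.g.hom ⧸ LinearMap.range S.moduleCatToCycles) := (i1 ≪≫ i2 ≪≫ i3).toLinearEquiv
  have hg : ∀ f : P.complex.X (n+1) ⟶ B, S.g.hom f = P.complex.d (n+2) (n+1) ≫ f := by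
    intro f
    rfl
  have hf : ∀ f : P.complex.X n ⟶ B, S.f.hom f = P.complex.d (n+1) n ≫ f := by
    intro f
    rfl
  let ψ : LinearMap.ker (LinearMap.lcomp R B (P.complex.d (n+2) (n+1)).hom) →ₗ[R] LinearMap.ker S.g.hom :=
    { toFun := fun z => ⟨(ModuleCat.ofHom z.1 : P.complex.X (n+1) ⟶ B), by
        have h1 := LinearMap.mem_ker.1 z.2
        exact LinearMap.mem_ker.2 ((hg (ModuleCat.ofHom z.1)).trans (ModuleCat.hom_ext h1))⟩
      map_add' := fun x y => rfl
      map_smul' := fun r x => rfl }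
  have hψ : Function.Surjective ψ := by
    rintro ⟨f, h⟩
    rw [LinearMap.mem_ker] at h
    have h2 := (hg f).symm.trans h
    exact ⟨⟨(f : P.complex.X (n+1) ⟶ B).hom, by
      rw [LinearMap.mem_ker]
      exact congrArg ModuleCat.Hom.hom h2⟩, rfl⟩
  refine ⟨i.symm.toLinearMap ∘ₗ (LinearMap.range S.moduleCatToCycles).mkQ ∘ₗ ψ, ?_, ?_⟩
  · exact i.symm.surjective.comp ((Submodule.mkQ_surjective _).comp hψ)
  · intro z
    simp only [LinearMap.comp_apply, LinearEquiv.coe_coe, LinearEquiv.map_eq_zero_iff, Submodule.mkQ_apply, Submodule.Quotient.mk_eq_zero, LinearMap.mem_range]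
    constructor
    · rintro ⟨y, hy⟩
      refine ⟨(y : P.complex.X n ⟶ B).hom, ?_⟩
      have := congrArg Subtype.val hy
      exact (congrArg ModuleCat.Hom.hom this).symm
    · rintro ⟨g, hg⟩
      refine ⟨(ModuleCat.ofHom g : P.complex.X n ⟶ B), ?_⟩
      apply Subtype.ext
      exact congrArg ModuleCat.ofHom hg.symm

section
variable {C : Type*} [Category C] [Abelian C] [EnoughProjectives C] {X₁ X₀ Z : C} (d : X₁ ⟶ X₀) (q : X₀ ⟶ Z)

def presSucc {X Y : C} (f : X ⟶ Y) : Σ' (W : C) (e : W ⟶ X), e ≫ f = 0 :=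
  ⟨Projective.over (Limits.kernel f), Projective.π (Limits.kernel f) ≫ Limits.kernel.ι f,
    by rw [Category.assoc, Limits.kernel.condition, Limits.comp_zero]⟩

lemma presSucc_exact {X Y : C} (f : X ⟶ Y) :
    (ShortComplex.mk (presSucc f).2.1 f (presSucc f).2.2).Exact :=
  exact_d_f f

def presComplex : ChainComplex C ℕ :=
  ChainComplex.mk' X₀ X₁ d (fun f => presSucc f)

def presIso (n : ℕ) : (presSucc ((presComplex d).d (n+1) n)).1 ≅ (presComplex d).X (n+2) :=
  (ChainComplex.mk'XIso X₀ X₁ d (fun f => presSucc f) n).symm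

lemma presIso_hom (n : ℕ) : (presIso d n).hom ≫ (presComplex d).d (n+2) (n+1) =
    (presSucc ((presComplex d).d (n+1) n)).2.1 := by
  rw [← Iso.eq_inv_comp]
  exact ChainComplex.mk'_d X₀ X₁ d (fun f => presSucc f) n

lemma presComplex_exactAt_succ (n : ℕ) :
    (presComplex d).ExactAt (n + 1) := by
  rw [HomologicalComplex.exactAt_iff' _ (n + 1 + 1) (n + 1) n (by simp) (by simp)]
  refine ShortComplex.exact_of_iso ?_ (presSucc_exact ((presComplex d).d (n+1) n))
  exact ShortComplex.isoMk (presIso d n) (Iso.refl _) (Iso.refl _)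
    ((presIso_hom d n).trans (Category.comp_id _).symm)
    ((Category.id_comp _).trans (Category.comp_id _).symm)

lemma presComplex_proj [Projective X₁] [Projective X₀] (n : ℕ) : Projective ((presComplex d).X n) := by
  obtain (_ | _ | n) := n
  · assumption
  · assumption
  · exact Projective.of_iso (presIso d n) (Projective.projective_over _)

lemma presComplex_d : (presComplex d).d 1 0 = d := ChainComplex.mk'_d_1_0 _ _ _ _

def presRes [Projective X₁] [Projective X₀] [Epi q] (w : d ≫ q = 0) (h : (ShortComplex.mk d q w).Exact) :
    ProjectiveResolution Z where
  complex := presComplex d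
  projective := presComplex_proj d
  π := (ChainComplex.toSingle₀Equiv _ _).symm ⟨q, (congrArg (· ≫ q) (presComplex_d d)).trans w⟩
  quasiIso := ⟨fun n => by
    cases n
    · rw [ChainComplex.quasiIsoAt₀_iff, ShortComplex.quasiIso_iff_of_zeros']
      · refine (ShortComplex.exact_and_epi_g_iff_of_iso ?_).2
          ⟨h, (inferInstance : Epi q)⟩
        refine ShortComplex.isoMk (Iso.refl _) (Iso.refl _) (Iso.refl _) ?_ ?_
        · refine (Category.id_comp _).trans (Eq.trans ?_ (Category.comp_id _).symm)
          exact (presComplex_d d).symm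
        · refine (Category.id_comp _).trans (Eq.trans ?_ (Category.comp_id _).symm)
          exact (ChainComplex.toSingle₀Equiv_symm_apply_f_zero (C := presComplex d) (X := Z) q _).symm
      all_goals rfl
    · rw [quasiIsoAt_iff_exactAt']
      · apply presComplex_exactAt_succ
      · apply ChainComplex.exactAt_succ_single_obj⟩
end

lemma ext_data {R : Type} [CommRing R] {F₁ F₀ Z : Type}
    [AddCommGroup F₁] [Module R F₁] [AddCommGroup F₀] [Module R F₀] [AddCommGroup Z] [Module R Z]
    [Module.Projective R F₁] [Module.Projective R F₀]
    (δ : F₁ →ₗ[R] F₀) (q : F₀ →ₗ[R] Z) (hq : Function.Surjective q)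
    (hδ : Function.Exact δ q) (B : Type) [AddCommGroup B] [Module R B] :
    ∃ (F₂ F₃ : ModuleCat.{0} R) (d₂ : F₂ →ₗ[R] F₁) (d₃ : F₃ →ₗ[R] F₂)
      (φ₁ : LinearMap.ker (LinearMap.lcomp R B d₂) →ₗ[R]
        ((Ext R (ModuleCat R) 1).obj (Opposite.op (ModuleCat.of R Z))).obj (ModuleCat.of R B))
      (φ₂ : LinearMap.ker (LinearMap.lcomp R B d₃) →ₗ[R]
        ((Ext R (ModuleCat R) 2).obj (Opposite.op (ModuleCat.of R Z))).obj (ModuleCat.of R B)),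
      Function.Exact d₂ δ ∧ Function.Exact d₃ d₂ ∧
      Function.Surjective φ₁ ∧ (∀ z, φ₁ z = 0 ↔ ∃ g : F₀ →ₗ[R] B, z.1 = g ∘ₗ δ) ∧
      Function.Surjective φ₂ ∧ (∀ z, φ₂ z = 0 ↔ ∃ g : F₁ →ₗ[R] B, z.1 = g ∘ₗ d₂) := by
  let δ' := ModuleCat.ofHom δ
  let q' := ModuleCat.ofHom q
  have w : δ' ≫ q' = 0 := by
    ext x
    exact hδ.apply_apply_eq_zero x
  have : Epi q' := (ModuleCat.epi_iff_surjective _).2 hq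
  have he : (ShortComplex.mk δ' q' w).Exact :=
    (ShortComplex.ShortExact.moduleCat_exact_iff_function_exact _).2 hδ
  have : Projective (ModuleCat.of R F₁) := ModuleCat.projective_of_categoryTheory_projective _
  have : Projective (ModuleCat.of R F₀) := inferInstance
  let P := presRes δ' q' w he
  obtain ⟨φ₁, h1, h1'⟩ := ext_aux P (ModuleCat.of R B) 0
  obtain ⟨φ₂, h2, h2'⟩ := ext_aux P (ModuleCat.of R B) 1
  have e1 := (ShortComplex.ShortExact.moduleCat_exact_iff_function_exact _).1 (P.exact_succ 0)
  have e2 := (ShortComplex.ShortExact.moduleCat_exact_iff_function_exact _).1 (P.exact_succ 1)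
  have hd : P.complex.d 1 0 = δ' := presComplex_d δ'
  refine ⟨P.complex.X 2, P.complex.X 3, (P.complex.d 2 1).hom, (P.complex.d 3 2).hom, φ₁, φ₂,
    ?_, e2, h1, ?_, h2, h2'⟩
  · intro x
    refine Iff.trans ?_ (e1 x)
    exact Eq.congr (LinearMap.congr_fun (congrArg ModuleCat.Hom.hom hd.symm) x) rfl
  · intro z
    refine (h1' z).trans ?_
    rw [hd]
    rfl

lemma exists_factor {R : Type*} [CommRing R] {M N Q : Type*} [AddCommGroup M] [Module R M]
    [AddCommGroup N] [Module R N] [AddCommGroup Q] [Module R Q] (e : M →ₗ[R] N) (he : Function.Surjective e)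
    (z : M →ₗ[R] Q) (h : LinearMap.ker e ≤ LinearMap.ker z) : ∃ k : N →ₗ[R] Q, ∀ x, k (e x) = z x := by
  refine ⟨(LinearMap.ker e).liftQ z h ∘ₗ (e.quotKerEquivOfSurjective he).symm.toLinearMap, fun x => ?_⟩
  have : (e.quotKerEquivOfSurjective he).symm (e x) = Submodule.Quotient.mk x := by
    rw [LinearEquiv.symm_apply_eq]; rfl
  simp [this]

/-- The canonical isomorphism `P ⊗ B ≃ Hom(P*, B)` for `P` finite projective. -/
def thetaEquiv (R : Type*) [CommRing R] (P B : Type*) [AddCommGroup P] [Module R P]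
    [AddCommGroup B] [Module R B] [Module.Finite R P] [Module.Projective R P] :
    (P ⊗[R] B) ≃ₗ[R] ((P →ₗ[R] R) →ₗ[R] B) :=
  (TensorProduct.congr (Module.evalEquiv R P) (LinearEquiv.refl R B)).trans
    (dualTensorHomEquiv R (Module.Dual R P) B)

lemma thetaEquiv_tmul {R : Type*} [CommRing R] {P B : Type*} [AddCommGroup P] [Module R P]
    [AddCommGroup B] [Module R B] [Module.Finite R P] [Module.Projective R P] (x : P) (b : B)
    (f : P →ₗ[R] R) : thetaEquiv R P B (x ⊗ₜ b) f = f x • b := by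
  simp [thetaEquiv, dualTensorHom_apply]

lemma core {R : Type} [CommRing R]
    (A : Type) [AddCommGroup A] [Module R A]
    (P₁ P₀ : Type) [AddCommGroup P₁] [Module R P₁] [AddCommGroup P₀] [Module R P₀]
    [Module.Finite R P₁] [Module.Projective R P₁]
    [Module.Finite R P₀] [Module.Projective R P₀]
    (d : P₁ →ₗ[R] P₀) (p : P₀ →ₗ[R] A)
    (hp : Function.Surjective p) (hdp : LinearMap.range d = LinearMap.ker p)
    (B : Type) [AddCommGroup B] [Module R B]
    (ρ : (A ⊗[R] B) →ₗ[R] ((A →ₗ[R] R) →ₗ[R] B))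
    (hρ : ∀ (a : A) (b : B) (f : A →ₗ[R] R), ρ (a ⊗ₜ b) f = f a • b)
    {F₂ F₃ E₁ E₂ : Type} [AddCommGroup F₂] [Module R F₂] [AddCommGroup F₃] [Module R F₃]
    [AddCommGroup E₁] [Module R E₁] [AddCommGroup E₂] [Module R E₂]
    (d₂ : F₂ →ₗ[R] (P₀ →ₗ[R] R)) (d₃ : F₃ →ₗ[R] F₂)
    (φ₁ : LinearMap.ker (LinearMap.lcomp R B d₂) →ₗ[R] E₁)
    (φ₂ : LinearMap.ker (LinearMap.lcomp R B d₃) →ₗ[R] E₂)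
    (h₂ : Function.Exact d₂ (d.dualMap : (P₀ →ₗ[R] R) →ₗ[R] (P₁ →ₗ[R] R)))
    (h₃ : Function.Exact d₃ d₂)
    (s₁ : Function.Surjective φ₁)
    (k₁ : ∀ z, φ₁ z = 0 ↔ ∃ g : (P₁ →ₗ[R] R) →ₗ[R] B,
      z.1 = g ∘ₗ (d.dualMap : (P₀ →ₗ[R] R) →ₗ[R] (P₁ →ₗ[R] R)))
    (s₂ : Function.Surjective φ₂)
    (k₂ : ∀ z, φ₂ z = 0 ↔ ∃ g : (P₀ →ₗ[R] R) →ₗ[R] B, z.1 = g ∘ₗ d₂) :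
    ∃ (α : E₁ →+ (A ⊗[R] B)) (β : ((A →ₗ[R] R) →ₗ[R] B) →+ E₂),
      Function.Injective α ∧ Function.Exact α ρ ∧ Function.Exact ρ β ∧
        Function.Surjective β := by
  have hdp' : Function.Exact d p := LinearMap.exact_iff.2 hdp.symm
  let ps : (A →ₗ[R] R) →ₗ[R] (P₀ →ₗ[R] R) := p.dualMap
  have ps_inj : Function.Injective ps := LinearMap.dualMap_injective_of_surjective hp
  have range_ps : ∀ f, f ∈ LinearMap.range ps ↔ ∃ x, d₂ x = f := by
    intro f
    rw [← Set.mem_range, ← h₂ f]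
    constructor
    · rintro ⟨g, rfl⟩
      ext x
      simp [ps, hdp'.apply_apply_eq_zero]
    · intro hf
      obtain ⟨g, hg⟩ := exists_factor p hp f (by
        rw [← hdp]
        rintro _ ⟨y, rfl⟩
        exact LinearMap.congr_fun hf y)
      exact ⟨g, LinearMap.ext hg⟩
  -- the lift `e : F₂ → A*`
  let e : F₂ →ₗ[R] (A →ₗ[R] R) := (LinearEquiv.ofInjective ps ps_inj).symm.toLinearMap ∘ₗ
    d₂.codRestrict (LinearMap.range ps) (fun x => (range_ps _).2 ⟨x, rfl⟩)
  have he : ∀ x, ps (e x) = d₂ x := by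
    intro x
    have := LinearEquiv.apply_symm_apply (LinearEquiv.ofInjective ps ps_inj)
      (d₂.codRestrict (LinearMap.range ps) (fun x => (range_ps _).2 ⟨x, rfl⟩) x)
    exact congrArg Subtype.val this
  have e_surj : Function.Surjective e := by
    intro f
    obtain ⟨x, hx⟩ := (range_ps (ps f)).1 ⟨f, rfl⟩
    exact ⟨x, ps_inj ((he x).trans hx)⟩
  have e_ker : ∀ x, e x = 0 ↔ ∃ y, d₃ y = x := by
    intro x
    rw [← Set.mem_range, ← h₃ x, ← he x]
    exact ⟨fun h => by rw [h, map_zero], fun h => ps_inj (h.trans (map_zero ps).symm)⟩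
  let θ₀ := thetaEquiv R P₀ B
  let θ₁ := thetaEquiv R P₁ B
  have hp₀ : ∀ t, ρ (LinearMap.rTensor B p t) = θ₀ t ∘ₗ ps := by
    intro t
    induction t with
    | zero => simp
    | add x y hx hy => rw [map_add, map_add, hx, hy, map_add, LinearMap.add_comp]
    | tmul x b =>
      ext f
      simp [hρ, θ₀, thetaEquiv_tmul, ps]
  have hd₁ : ∀ t, θ₀ (LinearMap.rTensor B d t) = θ₁ t ∘ₗ d.dualMap := by
    intro t
    induction t with
    | zero => simp
    | add x y hx hy => rw [map_add, map_add, hx, hy, map_add, LinearMap.add_comp]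
    | tmul x b =>
      ext f
      simp [θ₀, θ₁, thetaEquiv_tmul]
  have hex : Function.Exact (LinearMap.rTensor B d) (LinearMap.rTensor B p) :=
    rTensor_exact B hdp' hp
  have hsurj : Function.Surjective (LinearMap.rTensor B p) := LinearMap.rTensor_surjective B hp
  let m : LinearMap.ker (LinearMap.lcomp R B d₂) →ₗ[R] A ⊗[R] B :=
    LinearMap.rTensor B p ∘ₗ θ₀.symm.toLinearMap ∘ₗ Submodule.subtype _
  have hm : ∀ z, m z = LinearMap.rTensor B p (θ₀.symm z.1) := fun z => rfl
  have m_ker : ∀ z, m z = 0 ↔ φ₁ z = 0 := by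
    intro z
    rw [k₁, hm, hex]
    constructor
    · rintro ⟨t, ht⟩
      refine ⟨θ₁ t, ?_⟩
      rw [← hd₁, ht, LinearEquiv.apply_symm_apply]
    · rintro ⟨g, hg⟩
      refine ⟨θ₁.symm g, ?_⟩
      rw [LinearEquiv.eq_symm_apply, hd₁, LinearEquiv.apply_symm_apply, hg]
  obtain ⟨α, hα⟩ := exists_factor φ₁ s₁ m (fun z hz => (m_ker z).2 hz)
  let β : ((A →ₗ[R] R) →ₗ[R] B) →ₗ[R] E₂ := φ₂ ∘ₗ
    (LinearMap.lcomp R B e).codRestrict (LinearMap.ker (LinearMap.lcomp R B d₃)) (fun h => by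
      rw [LinearMap.mem_ker]
      ext y
      have : e (d₃ y) = 0 := (e_ker _).2 ⟨y, rfl⟩
      simp [this])
  have hβ : ∀ h, β h = 0 ↔ ∃ g : (P₀ →ₗ[R] R) →ₗ[R] B, h = g ∘ₗ ps := by
    intro h
    refine (k₂ _).trans (exists_congr fun g => ?_)
    constructor
    · intro hh
      refine LinearMap.ext fun f => ?_
      obtain ⟨x, rfl⟩ := e_surj f
      refine (LinearMap.congr_fun hh x).trans ?_
      simp [he]
    · rintro rfl
      refine LinearMap.ext fun x => ?_
      exact congrArg g (he x)
  refine ⟨α.toAddMonoidHom, β.toAddMonoidHom, ?_, ?_, ?_, ?_⟩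
  · change Function.Injective α
    rw [injective_iff_map_eq_zero]
    intro y hy
    obtain ⟨z, rfl⟩ := s₁ y
    rw [hα] at hy
    exact (m_ker z).1 hy
  · change Function.Exact α ρ
    intro y
    constructor
    · intro hy
      obtain ⟨t, rfl⟩ := hsurj y
      rw [hp₀] at hy
      refine ⟨φ₁ ⟨θ₀ t, ?_⟩, ?_⟩
      · rw [LinearMap.mem_ker]
        ext x
        change θ₀ t (d₂ x) = 0
        rw [← he]
        exact LinearMap.congr_fun hy (e x)
      · rw [hα, hm, LinearEquiv.symm_apply_apply]
    · rintro ⟨w, rfl⟩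
      obtain ⟨z, rfl⟩ := s₁ w
      rw [hα, hm, hp₀, LinearEquiv.apply_symm_apply]
      refine LinearMap.ext fun f => ?_
      obtain ⟨x, rfl⟩ := e_surj f
      change z.1 (ps (e x)) = 0
      rw [he]
      exact LinearMap.congr_fun (LinearMap.mem_ker.1 z.2) x
  · change Function.Exact ρ β
    intro h
    rw [hβ]
    constructor
    · rintro ⟨g, rfl⟩
      exact ⟨LinearMap.rTensor B p (θ₀.symm g), by rw [hp₀, LinearEquiv.apply_symm_apply]⟩
    · rintro ⟨y, rfl⟩
      obtain ⟨t, rfl⟩ := hsurj y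
      exact ⟨θ₀ t, hp₀ t⟩
  · change Function.Surjective β
    intro y
    obtain ⟨z, rfl⟩ := s₂ y
    obtain ⟨k, hk⟩ := exists_factor e e_surj z.1 (fun x hx => by
      obtain ⟨y, rfl⟩ := (e_ker x).1 hx
      exact LinearMap.congr_fun (LinearMap.mem_ker.1 z.2) y)
    exact ⟨k, congrArg φ₂ (Subtype.ext (LinearMap.ext hk))⟩

end

/-- For a finitely presented module `A` over a commutative ring `R`, with presentation
`P₁ →d P₀ →p A → 0` by finitely generated projectives, and any `R`-module `B`, there is
an exact sequence
`0 → Ext¹(Tr A, B) → A ⊗ B → Hom(A*, B) → Ext²(Tr A, B) → 0`,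
where the middle map is the canonical map `ρ` with `ρ(a ⊗ b)(f) = f(a) • b`. -/
theorem auslander_sequence_ext {R : Type} [CommRing R]
    (A : Type) [AddCommGroup A] [Module R A]
    (P₁ P₀ : Type) [AddCommGroup P₁] [Module R P₁] [AddCommGroup P₀] [Module R P₀]
    [Module.Finite R P₁] [Module.Projective R P₁]
    [Module.Finite R P₀] [Module.Projective R P₀]
    (d : P₁ →ₗ[R] P₀) (p : P₀ →ₗ[R] A)
    (hp : Function.Surjective p) (hdp : LinearMap.range d = LinearMap.ker p)
    (B : Type) [AddCommGroup B] [Module R B]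
    (ρ : (A ⊗[R] B) →ₗ[R] ((A →ₗ[R] R) →ₗ[R] B))
    (hρ : ∀ (a : A) (b : B) (f : A →ₗ[R] R), ρ (a ⊗ₜ b) f = f a • b) :
    ∃ (α : ExtTr d 1 B →+ (A ⊗[R] B)) (β : ((A →ₗ[R] R) →ₗ[R] B) →+ ExtTr d 2 B),
      Function.Injective α ∧ Function.Exact α ρ ∧ Function.Exact ρ β ∧
        Function.Surjective β := by
  have : Module.Projective R (P₁ →ₗ[R] R) := inferInstanceAs (Module.Projective R (Module.Dual R P₁))
  have : Module.Projective R (P₀ →ₗ[R] R) := inferInstanceAs (Module.Projective R (Module.Dual R P₀))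
  let δ : (P₀ →ₗ[R] R) →ₗ[R] (P₁ →ₗ[R] R) := d.dualMap
  obtain ⟨F₂, F₃, d₂, d₃, φ₁, φ₂, h₂, h₃, s₁, k₁, s₂, k₂⟩ := ext_data δ (LinearMap.range δ).mkQ
    (Submodule.mkQ_surjective _) (LinearMap.exact_iff.2 (Submodule.ker_mkQ _)) B
  have key := core A P₁ P₀ d p hp hdp B ρ hρ d₂ d₃ φ₁ φ₂ h₂ h₃ s₁ k₁ s₂ k₂
  exact key
end

section
/- Let R be a commutative ring and A a finitely presented R-module with a presentation P₁ →d P₀ → A → 0 in which P₀, P₁ are finitely generated projective; write (−)* = Hom_R(−, R) and Tr A := coker(d* : P₀* → P₁*). Then for every R-module B there exist homomorphisms making the sequence 0 → Tor₂^R(Tr A, B) → A* ⊗_R B →λ Hom_R(A, B) → Tor₁^R(Tr A, B) → 0 exact, where λ is the canonical map determined by λ(f ⊗ b)(a) = f(a)·b for f ∈ A*, b ∈ B, a ∈ A. -/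
open TensorProduct CategoryTheory

/-- The abelian group `Tor_n^R(Tr A, B)`. -/
noncomputable def TorTr {R : Type} [CommRing R] {P₁ P₀ : Type}
    [AddCommGroup P₁] [Module R P₁] [AddCommGroup P₀] [Module R P₀]
    (d : P₁ →ₗ[R] P₀) (n : ℕ) (B : Type) [AddCommGroup B] [Module R B] : Type :=
  ((Tor (ModuleCat R) n).obj (ModuleCat.of R (Transpose d))).obj (ModuleCat.of R B)

noncomputable instance {R : Type} [CommRing R] {P₁ P₀ : Type}
    [AddCommGroup P₁] [Module R P₁] [AddCommGroup P₀] [Module R P₀]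
    (d : P₁ →ₗ[R] P₀) (n : ℕ) (B : Type) [AddCommGroup B] [Module R B] :
    AddCommGroup (TorTr d n B) :=
  inferInstanceAs (AddCommGroup
    (((Tor (ModuleCat R) n).obj (ModuleCat.of R (Transpose d))).obj (ModuleCat.of R B)))

section AuslanderAux

lemma aux_homology {R : Type} [CommRing R] (S : ShortComplex (ModuleCat.{0} R))
    {W Z : Type} [AddCommGroup W] [Module R W] [AddCommGroup Z] [Module R Z]
    (q : S.X₂ →ₗ[R] W) (hq : Function.Surjective q)
    (hex : Function.Exact S.f.hom q) (j : W →ₗ[R] Z)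
    (hj : ∀ x, S.g.hom x = 0 ↔ j (q x) = 0) :
    ∃ u : S.homology →ₗ[R] W, Function.Injective u ∧ Function.Exact u j := by
  let v : (LinearMap.ker S.g.hom ⧸ LinearMap.range S.moduleCatToCycles) →ₗ[R] W :=
    (LinearMap.range S.moduleCatToCycles).liftQ (q ∘ₗ (LinearMap.ker S.g.hom).subtype) (by
      rintro _ ⟨x, rfl⟩
      exact hex.apply_apply_eq_zero x)
  have hv : Function.Injective v := by
    rw [injective_iff_map_eq_zero]
    intro x hx
    obtain ⟨x, rfl⟩ := Submodule.mkQ_surjective _ x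
    have hx' : q x.1 = 0 := hx
    obtain ⟨y, hy⟩ := (hex _).1 hx'
    rw [Submodule.mkQ_apply, Submodule.Quotient.mk_eq_zero]
    exact ⟨y, Subtype.ext hy⟩
  have hvj : Function.Exact v j := by
    intro w
    constructor
    · intro hw
      obtain ⟨x, rfl⟩ := hq w
      exact ⟨Submodule.Quotient.mk ⟨x, (hj x).2 hw⟩, rfl⟩
    · rintro ⟨x, rfl⟩
      obtain ⟨x, rfl⟩ := Submodule.mkQ_surjective _ x
      exact (hj x.1).1 x.2
  let e : S.homology ≃ₗ[R] (LinearMap.ker S.g.hom ⧸ LinearMap.range S.moduleCatToCycles) :=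
    S.moduleCatHomologyIso.toLinearEquiv
  refine ⟨v ∘ₗ e.toLinearMap, hv.comp e.injective, ?_⟩
  intro w
  rw [hvj w]
  constructor
  · rintro ⟨x, rfl⟩
    exact ⟨e.symm x, by simp⟩
  · rintro ⟨x, rfl⟩
    exact ⟨e x, rfl⟩

/-- The higher `Tor` as a kernel, computed from a projective resolution. -/
lemma aux_tor {R : Type} [CommRing R] (T B : ModuleCat.{0} R) (Q : ProjectiveResolution B) (n : ℕ)
    {K : Type} [AddCommGroup K] [Module R K]
    (e : Q.complex.X (n + 1) →ₗ[R] K) (he : Function.Surjective e)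
    (hde : Function.Exact (Q.complex.d (n + 2) (n + 1)).hom e)
    (i : K →ₗ[R] Q.complex.X n) (hi : i ∘ₗ e = (Q.complex.d (n + 1) n).hom) :
    ∃ u : ((Tor (ModuleCat R) (n + 1)).obj T).obj B →ₗ[R] (T ⊗[R] K),
      Function.Injective u ∧ Function.Exact u (i.lTensor T) := by
  let F := (MonoidalCategory.tensoringLeft (ModuleCat.{0} R)).obj T
  let C := (F.mapHomologicalComplex (ComplexShape.down ℕ)).obj Q.complex
  let S := C.sc' (n + 2) (n + 1) n
  let iso : ((Tor (ModuleCat R) (n + 1)).obj T).obj B ≅ S.homology :=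
    Q.isoLeftDerivedObj F (n + 1) ≪≫ C.homologyIsoSc' (n + 2) (n + 1) n (by simp) (by simp)
  obtain ⟨u, hu, hex⟩ := aux_homology S (e.lTensor T) (LinearMap.lTensor_surjective T he)
    (lTensor_exact T hde he) (i.lTensor T) (by
      intro x
      have : S.g.hom = i.lTensor T ∘ₗ e.lTensor T := by
        rw [← LinearMap.lTensor_comp, hi]; rfl
      rw [this]; rfl)
  let ee := iso.toLinearEquiv
  refine ⟨u ∘ₗ ee.toLinearMap, hu.comp ee.injective, ?_⟩
  intro w
  rw [hex w]
  constructor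
  · rintro ⟨x, rfl⟩
    exact ⟨ee.symm x, by simp⟩
  · rintro ⟨x, rfl⟩
    exact ⟨ee x, rfl⟩

variable {R : Type} [CommRing R]
    {A : Type} [AddCommGroup A] [Module R A]
    {P₁ P₀ : Type} [AddCommGroup P₁] [Module R P₁] [AddCommGroup P₀] [Module R P₀]
    [Module.Finite R P₁] [Module.Projective R P₁]
    [Module.Finite R P₀] [Module.Projective R P₀]
    (d : P₁ →ₗ[R] P₀) (p : P₀ →ₗ[R] A)

/-- `Hom(A, X) → P₀* ⊗ X`. -/
noncomputable def auxIota (X : Type) [AddCommGroup X] [Module R X] :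
    (A →ₗ[R] X) →ₗ[R] (Module.Dual R P₀ ⊗[R] X) :=
  (dualTensorHomEquiv R P₀ X).symm.toLinearMap ∘ₗ p.lcomp R X

lemma auxIota_apply (X : Type) [AddCommGroup X] [Module R X] (f : A →ₗ[R] X) :
    dualTensorHom R P₀ X (auxIota p X f) = f ∘ₗ p :=
  (dualTensorHomEquiv R P₀ X).apply_symm_apply _

lemma auxIota_inj (hp : Function.Surjective p) (X : Type) [AddCommGroup X] [Module R X] :
    Function.Injective (auxIota p X) := by
  intro f g h
  have h2 := congrArg (dualTensorHom R P₀ X) h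
  rw [auxIota_apply, auxIota_apply] at h2
  exact (LinearMap.cancel_right hp).1 h2

lemma auxIota_exact (hp : Function.Surjective p)
    (hdp : LinearMap.range d = LinearMap.ker p) (X : Type) [AddCommGroup X] [Module R X] :
    Function.Exact (auxIota p X) (d.dualMap.rTensor X) := by
  intro x
  have key : d.dualMap.rTensor X x = 0 ↔ dualTensorHom R P₀ X x ∘ₗ d = 0 := by
    rw [← (dualTensorHom_bijective (R := R) (M := P₁) (N := X)).1.eq_iff, map_zero]
    have := LinearMap.congr_fun (dualTensorHom_comp_rTensor_dualMap (P := X) d) x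
    simp only [LinearMap.comp_apply] at this
    rw [this]; rfl
  rw [key]
  constructor
  · intro h
    have hker : LinearMap.ker p ≤ LinearMap.ker (dualTensorHom R P₀ X x) := by
      rw [← hdp]; rintro _ ⟨y, rfl⟩; exact LinearMap.congr_fun h y
    let f : A →ₗ[R] X := (LinearMap.ker p).liftQ _ hker ∘ₗ
      (p.quotKerEquivOfSurjective hp).symm.toLinearMap
    refine ⟨f, (dualTensorHom_bijective (R := R) (M := P₀) (N := X)).1 ?_⟩
    rw [auxIota_apply]
    ext y
    have : (p.quotKerEquivOfSurjective hp).symm (p y) = Submodule.Quotient.mk y := by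
      rw [LinearEquiv.symm_apply_eq]; rfl
    simp [f, this]
  · rintro ⟨f, rfl⟩
    rw [auxIota_apply]
    ext y
    have : d y ∈ LinearMap.ker p := hdp ▸ LinearMap.mem_range_self d y
    simp [LinearMap.mem_ker.1 this]

lemma aux_lambda_proj (hp : Function.Surjective p) (X : Type) [AddCommGroup X] [Module R X] [Module.Projective R X] :
    Function.Bijective (dualTensorHom R A X) :=
  haveI : Module.Finite R A := Module.Finite.of_surjective p hp
  dualTensorHom_bijective_of_finite_left_projective_right

/-- Connecting map `Hom(A, B) → Tr A ⊗ K`. -/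
lemma aux_snake (hp : Function.Surjective p)
    (hdp : LinearMap.range d = LinearMap.ker p) {K Q B : Type} [AddCommGroup K] [Module R K] [AddCommGroup Q] [Module R Q]
    [AddCommGroup B] [Module R B] [Module.Projective R Q]
    (i : K →ₗ[R] Q) (e : Q →ₗ[R] B) (hi : Function.Injective i) (hie : Function.Exact i e)
    (he : Function.Surjective e) :
    ∃ δ : (A →ₗ[R] B) →ₗ[R] (Transpose d ⊗[R] K),
      Function.Exact (dualTensorHom R A B) δ ∧ Function.Exact δ (i.lTensor (Transpose d)) := by
  let m : Module.Dual R P₁ →ₗ[R] Transpose d := (LinearMap.range d.dualMap).mkQ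
  have hm : Function.Surjective m := Submodule.mkQ_surjective _
  have hdm : Function.Exact d.dualMap m := LinearMap.exact_map_mkQ_range _
  have hf := lTensor_exact (Module.Dual R P₀) hie he
  have hg := lTensor_exact (Module.Dual R P₁) hie he
  have h1 : (i.lTensor (Module.Dual R P₁)) ∘ₗ (d.dualMap.rTensor K) =
      (d.dualMap.rTensor Q) ∘ₗ (i.lTensor (Module.Dual R P₀)) := by
    rw [LinearMap.lTensor_comp_rTensor, LinearMap.rTensor_comp_lTensor]
  have h2 : (e.lTensor (Module.Dual R P₁)) ∘ₗ (d.dualMap.rTensor Q) =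
      (d.dualMap.rTensor B) ∘ₗ (e.lTensor (Module.Dual R P₀)) := by
    rw [LinearMap.lTensor_comp_rTensor, LinearMap.rTensor_comp_lTensor]
  have hf2 := LinearMap.lTensor_surjective (Module.Dual R P₀) he
  have hg1 := Module.Flat.lTensor_preserves_injective_linearMap (M := Module.Dual R P₁) i hi
  refine ⟨SnakeLemma.δ'
        (M₁ := Module.Dual R P₀ ⊗[R] K) (M₂ := Module.Dual R P₀ ⊗[R] Q)
        (M₃ := Module.Dual R P₀ ⊗[R] B) (N₁ := Module.Dual R P₁ ⊗[R] K)
        (N₂ := Module.Dual R P₁ ⊗[R] Q) (N₃ := Module.Dual R P₁ ⊗[R] B)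
        (d.dualMap.rTensor K) (d.dualMap.rTensor Q) (d.dualMap.rTensor B)
        (i.lTensor (Module.Dual R P₀)) (e.lTensor (Module.Dual R P₀)) hf
        (i.lTensor (Module.Dual R P₁)) (e.lTensor (Module.Dual R P₁)) hg h1 h2 (auxIota p B) (auxIota_exact d p hp hdp B)
    (m.rTensor K) (rTensor_exact K hdm hm) hf2 hg1, ?_, ?_⟩
  · have := SnakeLemma.exact_δ'_right
        (M₁ := Module.Dual R P₀ ⊗[R] K) (M₂ := Module.Dual R P₀ ⊗[R] Q)
        (M₃ := Module.Dual R P₀ ⊗[R] B) (N₁ := Module.Dual R P₁ ⊗[R] K)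
        (N₂ := Module.Dual R P₁ ⊗[R] Q) (N₃ := Module.Dual R P₁ ⊗[R] B)
        (d.dualMap.rTensor K) (d.dualMap.rTensor Q) (d.dualMap.rTensor B)
        (i.lTensor (Module.Dual R P₀)) (e.lTensor (Module.Dual R P₀)) hf
        (i.lTensor (Module.Dual R P₁)) (e.lTensor (Module.Dual R P₁)) hg h1 h2 (auxIota p Q)
      (auxIota_exact d p hp hdp Q) (auxIota p B) (auxIota_exact d p hp hdp B)
      (m.rTensor K) (rTensor_exact K hdm hm) hf2 hg1 (e.compRight R) (by
        refine LinearMap.ext fun f =>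
          (dualTensorHom_bijective (R := R) (M := P₀) (N := B)).1 ?_
        have nat := LinearMap.congr_fun (dualTensorHom_comp_lTensor (M := P₀) e) (auxIota p Q f)
        simp only [LinearMap.comp_apply] at nat ⊢
        rw [nat, auxIota_apply, auxIota_apply]
        rfl) (auxIota_inj p hp B)
    intro x
    rw [this x]
    have nat : ∀ y, dualTensorHom R A B (e.lTensor _ y) = e.compRight R (dualTensorHom R A Q y) :=
      LinearMap.congr_fun (dualTensorHom_comp_lTensor (M := A) e)
    constructor
    · rintro ⟨y, rfl⟩
      obtain ⟨z, rfl⟩ := (aux_lambda_proj p hp Q).2 y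
      exact ⟨_, nat z⟩
    · rintro ⟨y, rfl⟩
      obtain ⟨z, rfl⟩ := LinearMap.lTensor_surjective _ he y
      exact ⟨_, (nat z).symm⟩
  · exact SnakeLemma.exact_δ'_left
        (M₁ := Module.Dual R P₀ ⊗[R] K) (M₂ := Module.Dual R P₀ ⊗[R] Q)
        (M₃ := Module.Dual R P₀ ⊗[R] B) (N₁ := Module.Dual R P₁ ⊗[R] K)
        (N₂ := Module.Dual R P₁ ⊗[R] Q) (N₃ := Module.Dual R P₁ ⊗[R] B)
        (d.dualMap.rTensor K) (d.dualMap.rTensor Q) (d.dualMap.rTensor B)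
        (i.lTensor (Module.Dual R P₀)) (e.lTensor (Module.Dual R P₀)) hf
        (i.lTensor (Module.Dual R P₁)) (e.lTensor (Module.Dual R P₁)) hg h1 h2 (auxIota p B)
      (auxIota_exact d p hp hdp B)
      (m.rTensor K) (rTensor_exact K hdm hm) (m.rTensor Q) (rTensor_exact Q hdm hm) hf2 hg1
      (i.lTensor (Transpose d)) (by
        rw [LinearMap.lTensor_comp_rTensor, LinearMap.rTensor_comp_lTensor])
      (LinearMap.rTensor_surjective K hm)

lemma aux_gamma (hp : Function.Surjective p) {K Q B : Type} [AddCommGroup K] [Module R K] [AddCommGroup Q] [Module R Q]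
    [AddCommGroup B] [Module R B] [Module.Projective R Q]
    (i : K →ₗ[R] Q) (e : Q →ₗ[R] B) (hi : Function.Injective i) (hie : Function.Exact i e)
    (he : Function.Surjective e) :
    ∃ γ : (A →ₗ[R] K) →ₗ[R] (Module.Dual R A ⊗[R] B),
      Function.Exact (dualTensorHom R A K) γ ∧ Function.Exact γ (dualTensorHom R A B) := by
  let l := LinearEquiv.ofBijective _ (aux_lambda_proj p hp Q)
  have natK : ∀ y, l (i.lTensor _ y) = i ∘ₗ (dualTensorHom R A K y) :=
    LinearMap.congr_fun (dualTensorHom_comp_lTensor (M := A) i)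
  have natB : ∀ y, dualTensorHom R A B (e.lTensor _ y) = e ∘ₗ (l y) :=
    LinearMap.congr_fun (dualTensorHom_comp_lTensor (M := A) e)
  have hex := lTensor_exact (Module.Dual R A) hie he
  refine ⟨e.lTensor _ ∘ₗ l.symm.toLinearMap ∘ₗ i.compRight R, ?_, ?_⟩
  · intro f
    have h0 : (e.lTensor (Module.Dual R A) ∘ₗ l.symm.toLinearMap ∘ₗ i.compRight R) f =
      e.lTensor _ (l.symm (i ∘ₗ f)) := rfl
    rw [h0, hex]
    constructor
    · rintro ⟨y, hy⟩
      refine ⟨y, ?_⟩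
      rw [LinearEquiv.eq_symm_apply, natK] at hy
      exact (LinearMap.cancel_left hi).1 hy
    · rintro ⟨y, rfl⟩
      exact ⟨y, by rw [LinearEquiv.eq_symm_apply, natK]⟩
  · intro x
    constructor
    · intro hx
      obtain ⟨y, rfl⟩ := LinearMap.lTensor_surjective _ he x
      rw [natB] at hx
      have hr : ∀ a, l y a ∈ LinearMap.range i := fun a =>
        (hie _).1 (LinearMap.congr_fun hx a)
      let ei := LinearEquiv.ofInjective i hi
      let f : A →ₗ[R] K := ei.symm.toLinearMap ∘ₗ (l y).codRestrict _ hr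
      have hf : i ∘ₗ f = l y := by
        ext a
        exact congrArg Subtype.val (ei.apply_symm_apply ⟨l y a, hr a⟩)
      refine ⟨f, ?_⟩
      change e.lTensor _ (l.symm (i ∘ₗ f)) = _
      rw [hf, LinearEquiv.symm_apply_apply]
    · rintro ⟨f, rfl⟩
      change dualTensorHom R A B (e.lTensor _ (l.symm (i ∘ₗ f))) = _
      rw [natB, LinearEquiv.apply_symm_apply, ← LinearMap.comp_assoc,
        hie.linearMap_comp_eq_zero, LinearMap.zero_comp]

/-- Transport along `X → T' ⊇ range` of a map. -/
lemma aux_factor {X Y Z W : Type} [AddCommGroup X] [Module R X] [AddCommGroup Y] [Module R Y]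
    [AddCommGroup Z] [Module R Z] [AddCommGroup W] [Module R W]
    (f : X →ₗ[R] Y) (g : X →ₗ[R] Z) (u : W →ₗ[R] Y) (hu : Function.Injective u)
    (hr : LinearMap.range u = LinearMap.range f) (hk : LinearMap.ker f = LinearMap.ker g) :
    ∃ α : W →ₗ[R] Z, Function.Injective α ∧ LinearMap.range α = LinearMap.range g := by
  let e : W ≃ₗ[R] (X ⧸ LinearMap.ker g) :=
    LinearEquiv.ofInjective u hu ≪≫ₗ LinearEquiv.ofEq _ _ hr ≪≫ₗ f.quotKerEquivRange.symm ≪≫ₗ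
      Submodule.quotEquivOfEq _ _ hk
  refine ⟨(LinearMap.range g).subtype ∘ₗ (e ≪≫ₗ g.quotKerEquivRange).toLinearMap,
    (Submodule.injective_subtype _).comp (LinearEquiv.injective _), ?_⟩
  rw [LinearMap.range_comp_of_range_eq_top _ (LinearEquiv.range _), Submodule.range_subtype]

end AuslanderAux

/-- For a finitely presented module `A` over a commutative ring `R`, with presentation
`P₁ →d P₀ →p A → 0` by finitely generated projectives, and any `R`-module `B`, there is
an exact sequence
`0 → Tor₂(Tr A, B) → A* ⊗ B → Hom(A, B) → Tor₁(Tr A, B) → 0`,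
where the middle map is the canonical map `λ` with `λ(f ⊗ b)(a) = f(a) • b`. -/
theorem auslander_sequence_tor {R : Type} [CommRing R]
    (A : Type) [AddCommGroup A] [Module R A]
    (P₁ P₀ : Type) [AddCommGroup P₁] [Module R P₁] [AddCommGroup P₀] [Module R P₀]
    [Module.Finite R P₁] [Module.Projective R P₁]
    [Module.Finite R P₀] [Module.Projective R P₀]
    (d : P₁ →ₗ[R] P₀) (p : P₀ →ₗ[R] A)
    (hp : Function.Surjective p) (hdp : LinearMap.range d = LinearMap.ker p)
    (B : Type) [AddCommGroup B] [Module R B]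
    (lam : ((A →ₗ[R] R) ⊗[R] B) →ₗ[R] (A →ₗ[R] B))
    (hlam : ∀ (f : A →ₗ[R] R) (b : B) (a : A), lam (f ⊗ₜ b) a = f a • b) :
    ∃ (α : TorTr d 2 B →+ ((A →ₗ[R] R) ⊗[R] B)) (β : (A →ₗ[R] B) →+ TorTr d 1 B),
      Function.Injective α ∧ Function.Exact α lam ∧ Function.Exact lam β ∧
        Function.Surjective β := by
  have hl : lam = dualTensorHom R A B := by
    refine TensorProduct.ext' fun f b => LinearMap.ext fun a => ?_
    rw [hlam, dualTensorHom_apply]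
  subst hl
  let Q : ProjectiveResolution (ModuleCat.of R B) := Classical.choice
    (HasProjectiveResolutions.out (ModuleCat.of R B)).out
  have hproj : ∀ n, Module.Projective R (Q.complex.X n) := fun n =>
    (IsProjective.iff_projective _).2 (Q.projective n)
  let π : Q.complex.X 0 →ₗ[R] B := (Q.π.f 0).hom
  have hπ : Function.Surjective π := (ModuleCat.epi_iff_surjective _).1
    (inferInstance : Epi (Q.π.f 0))
  have ex0 : Function.Exact (Q.complex.d 1 0).hom π :=
    (ShortComplex.ShortExact.moduleCat_exact_iff_function_exact _).1 Q.exact₀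
  have exs : ∀ n, Function.Exact (Q.complex.d (n + 2) (n + 1)).hom (Q.complex.d (n + 1) n).hom :=
    fun n => (ShortComplex.ShortExact.moduleCat_exact_iff_function_exact _).1 (Q.exact_succ n)
  -- syzygies
  let K := LinearMap.ker π
  let e : Q.complex.X 1 →ₗ[R] K := (Q.complex.d 1 0).hom.codRestrict K
    (fun x => ex0.apply_apply_eq_zero x)
  have he : Function.Surjective e := by
    rintro ⟨x, hx⟩
    obtain ⟨y, hy⟩ := (ex0 x).1 hx
    exact ⟨y, Subtype.ext hy⟩
  have hde : Function.Exact (Q.complex.d 2 1).hom e := by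
    intro x
    rw [← exs 0 x]
    exact Subtype.ext_iff
  let L := LinearMap.ker e
  let e' : Q.complex.X 2 →ₗ[R] L := (Q.complex.d 2 1).hom.codRestrict L
    (fun x => hde.apply_apply_eq_zero x)
  have he' : Function.Surjective e' := by
    rintro ⟨x, hx⟩
    obtain ⟨y, hy⟩ := (hde x).1 hx
    exact ⟨y, Subtype.ext hy⟩
  have hde' : Function.Exact (Q.complex.d 3 2).hom e' := by
    intro x
    rw [← exs 1 x]
    exact Subtype.ext_iff
  obtain ⟨u₁, hu₁, hx₁⟩ := aux_tor (ModuleCat.of R (Transpose d)) (ModuleCat.of R B) Q 0 e he hde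
    K.subtype rfl
  obtain ⟨u₂, hu₂, hx₂⟩ := aux_tor (ModuleCat.of R (Transpose d)) (ModuleCat.of R B) Q 1 e' he'
    hde' L.subtype rfl
  obtain ⟨δ₁, h₁, h₁'⟩ := aux_snake d p hp hdp K.subtype π K.injective_subtype
    (LinearMap.exact_subtype_ker_map π) hπ
  obtain ⟨δ₂, h₂, h₂'⟩ := aux_snake d p hp hdp L.subtype e L.injective_subtype
    (LinearMap.exact_subtype_ker_map e) he
  obtain ⟨γ, h₃, h₃'⟩ := aux_gamma p hp K.subtype π K.injective_subtype
    (LinearMap.exact_subtype_ker_map π) hπ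
  have hr₂ : LinearMap.range u₂ = LinearMap.range δ₂ :=
    hx₂.linearMap_ker_eq.symm.trans h₂'.linearMap_ker_eq
  have hr₁ : LinearMap.range u₁ = LinearMap.range δ₁ :=
    hx₁.linearMap_ker_eq.symm.trans h₁'.linearMap_ker_eq
  have hk : LinearMap.ker δ₂ = LinearMap.ker γ :=
    h₂.linearMap_ker_eq.trans h₃.linearMap_ker_eq.symm
  obtain ⟨α, hα, hα'⟩ := aux_factor (Z := Module.Dual R A ⊗[R] B) δ₂ γ u₂ hu₂ hr₂ hk
  let v : _ ≃ₗ[R] LinearMap.range δ₁ :=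
    LinearEquiv.ofInjective u₁ hu₁ ≪≫ₗ LinearEquiv.ofEq _ _ hr₁
  let β := v.symm.toLinearMap ∘ₗ δ₁.rangeRestrict
  refine ⟨α.toAddMonoidHom, β.toAddMonoidHom, hα, ?_, ?_, ?_⟩
  · have : Function.Exact α (dualTensorHom R A B) := by
      rw [LinearMap.exact_iff, hα', h₃'.linearMap_ker_eq]
    exact this
  · have : Function.Exact (dualTensorHom R A B) β := by
      intro x
      rw [← h₁ x]
      change v.symm (δ₁.rangeRestrict x) = 0 ↔ _
      rw [LinearEquiv.map_eq_zero_iff]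
      exact Subtype.ext_iff
    exact this
  · exact v.symm.surjective.comp δ₁.surjective_rangeRestrict
end
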